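/- Let M be the free module over the abstract setup with highest weight vector v of (L_0,J_0)-weight (Δ,Λ) for the N=2 annihilation algebra, and suppose w = α ∂^k v + β ∂^{k−1} G^+_{−1/2} G^−_{−1/2} v (k ≥ 1, (α,β) ≠ (0,0)) satisfies G^+_{1/2} w = G^−_{1/2} w = J_1 w = 0. Then k = 1, Δ = −1/2, and either (α = 0 and Λ = 1) or (α = −2β and Λ = −1). -/

import Mathlib

/-- If `A D = D A + B` and `B` commutes with `D`, then `A D^(n+1) = D^(n+1) A + (n+1) D^n B`. -/
theorem Module.End.apply_pow_succ_apply {R V : Type*} [CommRing R] [AddCommGroup V] [Module R V]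
    {A B D : Module.End R V} (hA : ∀ x, A (D x) = D (A x) + B x)
    (hB : ∀ x, B (D x) = D (B x)) (n : ℕ) (x : V) :
    A ((D ^ (n + 1)) x) = (D ^ (n + 1)) (A x) + ((n : R) + 1) • (D ^ n) (B x) := by
  induction n generalizing x with
  | zero => simp [hA]
  | succ n ih =>
    rw [pow_succ, Module.End.mul_apply, ih, hA, hB, map_add]
    simp only [pow_succ, Module.End.mul_apply]
    push_cast
    module

/-- Lemma 4.1: in the `N = 2` Verma module `M_{NS²₊}(Δ,Λ)` (presented by operators on a
complex vector space `V` satisfying the `K(1,2)₊` relations, with highest weight vector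
`v` and with the standard `ℂ[∂]`-basis `∂^k v, ∂^k G⁺ v, ∂^k G⁻ v, ∂^k G⁺G⁻ v` linearly
independent over `ℂ`; half-integer indices encoded by `a : ℤ` standing for `r = a - 1/2`,
`∂ = L (-1)`), suppose `w = α ∂^k v + β ∂^{k-1} G⁺_{-1/2} G⁻_{-1/2} v` with `k ≥ 1`,
`(α,β) ≠ (0,0)`, is annihilated by `G⁺_{1/2}`, `G⁻_{1/2}` and `J₁`.  Then `k = 1`,
`Δ = -1/2`, and either `α = 0` and `Λ = 1`, or `α = -2β` and `Λ = -1`. -/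
theorem stmt_5 (V : Type*) [AddCommGroup V] [Module ℂ V]
    (L J Gp Gm : ℤ → Module.End ℂ V) (Δ Λ : ℂ) (v : V)
    (hLL : ∀ m n : ℤ, L m * L n - L n * L m = ((m : ℂ) - n) • L (m + n))
    (hLJ : ∀ m n : ℤ, L m * J n - J n * L m = (-(n : ℂ)) • J (m + n))
    (hJJ : ∀ m n : ℤ, J m * J n - J n * J m = 0)
    (hLGp : ∀ m a : ℤ, L m * Gp a - Gp a * L m = ((m : ℂ)/2 - ((a : ℂ) - 1/2)) • Gp (m + a))
    (hLGm : ∀ m a : ℤ, L m * Gm a - Gm a * L m = ((m : ℂ)/2 - ((a : ℂ) - 1/2)) • Gm (m + a))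
    (hJGp : ∀ m a : ℤ, J m * Gp a - Gp a * J m = Gp (m + a))
    (hJGm : ∀ m a : ℤ, J m * Gm a - Gm a * J m = (-1 : ℂ) • Gm (m + a))
    (hGpGm : ∀ a b : ℤ, Gp a * Gm b + Gm b * Gp a
      = (2 : ℂ) • L (a + b - 1) + ((a : ℂ) - (b : ℂ)) • J (a + b - 1))
    (hGpGp : ∀ a b : ℤ, Gp a * Gp b + Gp b * Gp a = 0)
    (hGmGm : ∀ a b : ℤ, Gm a * Gm b + Gm b * Gm a = 0)
    (hL0 : L 0 v = Δ • v) (hJ0 : J 0 v = Λ • v)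
    (hLpos : ∀ n : ℤ, 1 ≤ n → L n v = 0)
    (hJpos : ∀ n : ℤ, 1 ≤ n → J n v = 0)
    (hGppos : ∀ a : ℤ, 1 ≤ a → Gp a v = 0)
    (hGmpos : ∀ a : ℤ, 1 ≤ a → Gm a v = 0)
    (hbasis : LinearIndependent ℂ
      (fun p : ℕ × Fin 4 => ((L (-1)) ^ p.1) (![v, Gp 0 v, Gm 0 v, Gp 0 (Gm 0 v)] p.2)))
    (k : ℕ) (hk : 1 ≤ k) (α β : ℂ) (hαβ : ¬(α = 0 ∧ β = 0))
    (w : V)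
    (hw : w = α • ((L (-1)) ^ k) v + β • ((L (-1)) ^ (k - 1)) (Gp 0 (Gm 0 v)))
    (hsing1 : Gp 1 w = 0) (hsing2 : Gm 1 w = 0) (hsing3 : J 1 w = 0) :
    k = 1 ∧ Δ = -(1/2 : ℂ) ∧ ((α = 0 ∧ Λ = 1) ∨ (α = -2 * β ∧ Λ = -1)) := by
  have cLGp (m a : ℤ) (x : V) :
      L m (Gp a x) = Gp a (L m x) + ((m : ℂ) / 2 - ((a : ℂ) - 1 / 2)) • Gp (m + a) x := by
    simpa [sub_eq_iff_eq_add'] using LinearMap.congr_fun (hLGp m a) x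
  have cLGm (m a : ℤ) (x : V) :
      L m (Gm a x) = Gm a (L m x) + ((m : ℂ) / 2 - ((a : ℂ) - 1 / 2)) • Gm (m + a) x := by
    simpa [sub_eq_iff_eq_add'] using LinearMap.congr_fun (hLGm m a) x
  have cLJ (m n : ℤ) (x : V) : L m (J n x) = J n (L m x) + (-(n : ℂ)) • J (m + n) x := by
    have h := LinearMap.congr_fun (hLJ m n) x
    simp only [LinearMap.sub_apply, Module.End.mul_apply, LinearMap.smul_apply] at h
    exact sub_eq_iff_eq_add'.mp h
  have cJGp (m a : ℤ) (x : V) : J m (Gp a x) = Gp a (J m x) + Gp (m + a) x := by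
    simpa [sub_eq_iff_eq_add'] using LinearMap.congr_fun (hJGp m a) x
  have cJGm (m a : ℤ) (x : V) : J m (Gm a x) = Gm a (J m x) + (-1 : ℂ) • Gm (m + a) x := by
    have h := LinearMap.congr_fun (hJGm m a) x
    simp only [LinearMap.sub_apply, Module.End.mul_apply, LinearMap.smul_apply] at h
    exact sub_eq_iff_eq_add'.mp h
  have cGpGm (a b : ℤ) (x : V) : Gp a (Gm b x) + Gm b (Gp a x)
      = (2 : ℂ) • L (a + b - 1) x + ((a : ℂ) - b) • J (a + b - 1) x :=
    LinearMap.congr_fun (hGpGm a b) x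
  have cGpGp (a b : ℤ) (x : V) : Gp a (Gp b x) + Gp b (Gp a x) = 0 :=
    LinearMap.congr_fun (hGpGp a b) x
  have cGmGm (a b : ℤ) (x : V) : Gm a (Gm b x) + Gm b (Gm a x) = 0 :=
    LinearMap.congr_fun (hGmGm a b) x
  have sq (x : V) : Gp 0 (Gp 0 x) = 0 := by
    simpa [← two_smul ℂ] using cGpGp 0 0 x
  have sqm (x : V) : Gm 0 (Gm 0 x) = 0 := by
    simpa [← two_smul ℂ] using cGmGm 0 0 x
  have hGp1 := hGppos 1 le_rfl
  have hGm1 := hGmpos 1 le_rfl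
  have hJ1 := hJpos 1 le_rfl
  -- Commutation with powers of `∂`.
  have dGp0 (x : V) : Gp 0 (L (-1) x) = L (-1) (Gp 0 x) := by rw [cLGp]; norm_num
  have dGm0 (x : V) : Gm 0 (L (-1) x) = L (-1) (Gm 0 x) := by rw [cLGm]; norm_num
  have dJ0 (x : V) : J 0 (L (-1) x) = L (-1) (J 0 x) := by simp [cLJ]
  have dGp1 (x : V) : Gp 1 (L (-1) x) = L (-1) (Gp 1 x) + Gp 0 x := by
    rw [cLGp]; norm_num
  have dGm1 (x : V) : Gm 1 (L (-1) x) = L (-1) (Gm 1 x) + Gm 0 x := by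
    rw [cLGm]; norm_num
  have dJ1 (x : V) : J 1 (L (-1) x) = L (-1) (J 1 x) + J 0 x := by
    rw [cLJ]; norm_num
  -- Action on `G⁺G⁻ v`.
  have ePM : Gp 1 (Gm 0 v) = (2 * Δ + Λ) • v := by
    have h := cGpGm 1 0 v
    norm_num [hGp1, hL0, hJ0] at h
    rw [h]; module
  have eP : Gp 1 (Gp 0 (Gm 0 v)) = (-(2 * Δ + Λ)) • Gp 0 v := by
    rw [eq_neg_of_add_eq_zero_left (cGpGp 1 0 (Gm 0 v)), ePM, map_smul, neg_smul]
  have eL : L 0 (Gm 0 v) = (Δ + 1 / 2) • Gm 0 v := by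
    rw [cLGm, hL0, map_smul]; norm_num; module
  have eJm : J 0 (Gm 0 v) = (Λ - 1) • Gm 0 v := by
    rw [cJGm, hJ0, map_smul]; norm_num; module
  have eMM : Gm 1 (Gm 0 v) = 0 := by
    simpa [hGm1] using cGmGm 1 0 v
  have eM : Gm 1 (Gp 0 (Gm 0 v)) = (2 * Δ - Λ + 2) • Gm 0 v := by
    have h := cGpGm 0 1 (Gm 0 v)
    norm_num [eMM, eL, eJm] at h
    rw [h]; module
  have eM0 : Gm 0 (Gp 0 (Gm 0 v)) = (2 : ℂ) • L (-1) (Gm 0 v) := by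
    simpa [sqm] using cGpGm 0 0 (Gm 0 v)
  have eJ1 : J 1 (Gp 0 (Gm 0 v)) = (2 * Δ + Λ) • v := by
    rw [cJGp, cJGm, hJ1]
    norm_num [hGm1, ePM]
  have eJ0 : J 0 (Gp 0 (Gm 0 v)) = Λ • Gp 0 (Gm 0 v) := by
    rw [cJGp, eJm, map_smul]; norm_num; module
  obtain ⟨n, rfl⟩ : ∃ n, k = n + 1 := ⟨k - 1, by omega⟩
  rw [Nat.add_sub_cancel] at hw
  have hne (p : ℕ × Fin 4) := hbasis.ne_zero p
  have e1 : α * (n + 1) = β * (2 * Δ + Λ) := by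
    have h : (α * (n + 1) - β * (2 * Δ + Λ)) • (L (-1) ^ n) (Gp 0 v) = 0 := by
      rw [← hsing1, hw, map_add, map_smul, map_smul,
        Module.End.apply_pow_succ_apply dGp1 dGp0, hGp1]
      cases n with
      | zero => simp [eP]; module
      | succ n =>
        rw [Module.End.apply_pow_succ_apply dGp1 dGp0, eP, sq]
        simp only [map_zero, map_smul]
        module
    exact sub_eq_zero.mp ((smul_eq_zero.mp h).resolve_right (hne (n, 1)))
  have e2 : α * (n + 1) + β * (2 * Δ - Λ + 2 + 2 * n) = 0 := by
    have h : (α * (n + 1) + β * (2 * Δ - Λ + 2 + 2 * n)) • (L (-1) ^ n) (Gm 0 v) = 0 := by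
      rw [← hsing2, hw, map_add, map_smul, map_smul,
        Module.End.apply_pow_succ_apply dGm1 dGm0, hGm1]
      cases n with
      | zero => simp [eM]; module
      | succ n =>
        rw [Module.End.apply_pow_succ_apply dGm1 dGm0, eM, eM0]
        simp only [map_zero, map_smul, pow_succ, Module.End.mul_apply]
        push_cast
        module
    exact (smul_eq_zero.mp h).resolve_right (hne (n, 2))
  have e3 : α * (n + 1) * Λ + β * (2 * Δ + Λ) = 0 ∧ β * n * Λ = 0 := by
    have h := hsing3
    rw [hw, map_add, map_smul, map_smul,
      Module.End.apply_pow_succ_apply dJ1 dJ0, hJ1, hJ0] at h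
    cases n with
    | zero =>
      have h' : (α * ((0 : ℕ) + 1) * Λ + β * (2 * Δ + Λ)) • (L (-1) ^ 0) v = 0 := by
        rw [← h]; simp [eJ1]; module
      exact ⟨(smul_eq_zero.mp h').resolve_right (hne (0, 0)), by simp⟩
    | succ n =>
      rw [Module.End.apply_pow_succ_apply dJ1 dJ0, eJ1, eJ0] at h
      have hli := hbasis.comp ![(n + 1, 0), (n, 3)] (by
        intro i j; fin_cases i <;> fin_cases j <;> simp)
      have hp := LinearIndependent.pair_iff.mp (show LinearIndependent ℂ
        ![(L (-1) ^ (n + 1)) v, (L (-1) ^ n) (Gp 0 (Gm 0 v))] by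
          convert hli using 1
          ext i; fin_cases i <;> rfl)
      refine hp _ _ ?_
      rw [← h]
      simp only [map_zero, map_smul]
      push_cast
      module
  obtain ⟨e3, e4⟩ := e3
  have hn1 : (n : ℂ) + 1 ≠ 0 := Nat.cast_add_one_ne_zero n
  have hβ : β ≠ 0 := by
    rintro rfl
    exact hαβ ⟨by simpa [hn1] using e1, rfl⟩
  have hΔ : 2 * Δ + (n + 1) = 0 := by
    have : β * (2 * Δ + (n + 1)) = 0 := by linear_combination (e2 - e1) / 2
    exact (mul_eq_zero.mp this).resolve_left hβ
  have hΛ : (Λ - (n + 1)) * (Λ + 1) = 0 := by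
    have : β * ((Λ - (n + 1)) * (Λ + 1)) = 0 := by
      linear_combination e3 - Λ * e1 - β * (Λ + 1) * hΔ
    exact (mul_eq_zero.mp this).resolve_left hβ
  have hn : n = 0 := by
    by_contra h0
    have h0' : (n : ℂ) ≠ 0 := Nat.cast_ne_zero.mpr h0
    have hΛ0 : Λ = 0 := by simpa [hβ, h0'] using e4
    rw [hΛ0] at hΛ
    exact hn1 (by linear_combination -hΛ)
  subst hn
  norm_num at e1 hΔ hΛ
  refine ⟨rfl, by linear_combination hΔ / 2, ?_⟩
  rcases hΛ with h | h
  · have h1 : Λ = 1 := by linear_combination h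
    exact .inl ⟨by linear_combination e1 + β * hΔ + β * h, h1⟩
  · exact .inr ⟨by linear_combination e1 + β * hΔ + β * h, by linear_combination h⟩
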